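/- Let W be an xy-symmetric weight function on a measurable set Ω ⊆ ℝ² and {Sₙ} the MOPS of W, with invertible Gram matrices 𝐒ₙ = ∫_Ω Sₙ Sₙᵀ W dx dy, and set Γ_{n,k} = 𝐒ₙ L_{n−1,k}ᵀ 𝐒_{n−1}⁻¹ for n ≥ 1, k ∈ {1,2}. Suppose p_{n,k} are real bivariate polynomials with S_{2n,2k}(x,y) = p_{n,k}(x²,y²) (0 ≤ k ≤ n), set P̂ₙ = (p_{n,0},…,p_{n,n})ᵀ, and assume the Gram matrices 𝐏̂ₙ = ∫_{Ω*} P̂ₙ P̂ₙᵀ W^{(0,0)} du dv are invertible. Then for all n ≥ 0 and k ∈ {1,2} (u₁ = u, u₂ = v, matrices with negative indices being zero): (∫_{Ω*} u_k·P̂ₙ P̂ₙᵀ W^{(0,0)} du dv)·𝐏̂ₙ⁻¹ = J_n^{(0,0)}[L_{2n,k}Γ_{2n+1,k} + Γ_{2n,k}L_{2n−1,k}](J_n^{(0,0)})ᵀ, and for n ≥ 1: 𝐏̂ₙ L_{n−1,k}ᵀ 𝐏̂_{n−1}⁻¹ = J_n^{(0,0)} Γ_{2n,k} Γ_{2n−1,k}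 (J_{n−1}^{(0,0)})ᵀ. -/

import Mathlib

noncomputable section

open MeasureTheory MvPolynomial

/-- Evaluation of a bivariate polynomial at a point of `ℝ × ℝ`. -/
def ev (p : ℝ × ℝ) (f : MvPolynomial (Fin 2) ℝ) : ℝ := eval ![p.1, p.2] f

/-- `W` is a weight function on the measurable set `Ω ⊆ ℝ²`: nonnegative and measurable,
positive on a set of positive Lebesgue measure, with all moments finite. -/
def IsWeight (Ω : Set (ℝ × ℝ)) (W : ℝ × ℝ → ℝ) : Prop :=
  MeasurableSet Ω ∧ Measurable W ∧ (∀ p ∈ Ω, 0 ≤ W p) ∧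
    0 < volume {p | p ∈ Ω ∧ 0 < W p} ∧
    ∀ h k : ℕ, IntegrableOn (fun p : ℝ × ℝ => p.1 ^ h * p.2 ^ k * W p) Ω

/-- `W` is an `xy`-symmetric weight on `Ω`: `Ω` is invariant under `(x,y) ↦ (-x,y)` and
`(x,y) ↦ (x,-y)`, and `W(-x,y) = W(x,y) = W(x,-y)` on `Ω`. -/
def XYSymmetric (Ω : Set (ℝ × ℝ)) (W : ℝ × ℝ → ℝ) : Prop :=
  (∀ p : ℝ × ℝ, p ∈ Ω → (-p.1, p.2) ∈ Ω ∧ (p.1, -p.2) ∈ Ω) ∧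
    ∀ p ∈ Ω, W (-p.1, p.2) = W p ∧ W (p.1, -p.2) = W p

/-- `f` is monic of the form `x^(n-j) y^j + (terms of total degree < n)`. -/
def MonicLead (n j : ℕ) (f : MvPolynomial (Fin 2) ℝ) : Prop :=
  f = X 0 ^ (n - j) * X 1 ^ j ∨ (f - X 0 ^ (n - j) * X 1 ^ j).totalDegree < n

/-- `P` is the monic orthogonal polynomial system (MOPS) of the weight `W` on `Ω`:
each `P n j` is monic with leading term `x^(n-j) y^j`, and vectors of different degrees
are mutually orthogonal. -/
def IsMOPS (Ω : Set (ℝ × ℝ)) (W : ℝ × ℝ → ℝ)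
    (P : (n : ℕ) → Fin (n + 1) → MvPolynomial (Fin 2) ℝ) : Prop :=
  (∀ (n : ℕ) (j : Fin (n + 1)), MonicLead n (j : ℕ) (P n j)) ∧
    ∀ m n : ℕ, m ≠ n → ∀ (i : Fin (m + 1)) (j : Fin (n + 1)),
      ∫ p in Ω, ev p (P m i) * ev p (P n j) * W p = 0

/-- The image domain `Ω* = {(u,v) : u ≥ 0, v ≥ 0, (√u, √v) ∈ Ω}`. -/
def Ωstar (Ω : Set (ℝ × ℝ)) : Set (ℝ × ℝ) :=
  {q | 0 ≤ q.1 ∧ 0 ≤ q.2 ∧ (Real.sqrt q.1, Real.sqrt q.2) ∈ Ω}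

/-- The weight `W^(0,0)(u,v) = (1/4) (uv)^(-1/2) W(√u, √v)` on `Ω*`. -/
def W00 (W : ℝ × ℝ → ℝ) : ℝ × ℝ → ℝ :=
  fun q => (1 / 4) * W (Real.sqrt q.1, Real.sqrt q.2) / Real.sqrt (q.1 * q.2)

open Matrix in
/-- `Lmat n k` is the `(n+1) × (n+2)` matrix `L_{n,k}` (for `k = 1, 2`). -/
def Lmat (n k : ℕ) : Matrix (Fin (n + 1)) (Fin (n + 2)) ℝ :=
  Matrix.of fun h m => if (m : ℕ) = (h : ℕ) + (k - 1) then 1 else 0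

/-- `Jmat r c j` is the `r × c` matrix whose `(h, m)` entry is `1` iff `m = 2h + j`;
`J_n^(i,j)` is `Jmat (n+1) (2*n+1+i+j) j`. -/
def Jmat (r c j : ℕ) : Matrix (Fin r) (Fin c) ℝ :=
  Matrix.of fun h m => if (m : ℕ) = 2 * (h : ℕ) + j then 1 else 0

/-- The polynomials of total degree less than `n`. -/
def lowDegree (n : ℕ) : Submodule ℝ (MvPolynomial (Fin 2) ℝ) :=
  Submodule.span ℝ {f | ∃ a b : ℕ, a + b < n ∧ f = X 0 ^ a * X 1 ^ b}

lemma X_pow_mul_X_pow_mem_lowDegree {a b n : ℕ} (h : a + b < n) :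
    (X 0 ^ a * X 1 ^ b : MvPolynomial (Fin 2) ℝ) ∈ lowDegree n :=
  Submodule.subset_span ⟨a, b, h, rfl⟩

lemma lowDegree_mono {m n : ℕ} (h : m ≤ n) : lowDegree m ≤ lowDegree n :=
  Submodule.span_mono fun _ ⟨a, b, hab, hf⟩ => ⟨a, b, hab.trans_le h, hf⟩

lemma mem_lowDegree_of_totalDegree_lt {n : ℕ} {f : MvPolynomial (Fin 2) ℝ}
    (hf : f.totalDegree < n) : f ∈ lowDegree n := by
  rw [f.as_sum]
  refine Submodule.sum_mem _ fun d hd => ?_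
  have hdeg := le_totalDegree hd
  rw [Finsupp.sum_fintype _ _ (fun _ => rfl), Fin.sum_univ_two] at hdeg
  rw [monomial_eq, Finsupp.prod_fintype _ _ (fun _ => pow_zero _), Fin.prod_univ_two,
    ← smul_eq_C_mul]
  exact Submodule.smul_mem _ _ (X_pow_mul_X_pow_mem_lowDegree (by omega))

lemma MonicLead.sub_mem {n j : ℕ} {f : MvPolynomial (Fin 2) ℝ} (hf : MonicLead n j f) :
    f - X 0 ^ (n - j) * X 1 ^ j ∈ lowDegree n := by
  rcases hf with h | h
  · rw [h, sub_self]; exact zero_mem _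
  · exact mem_lowDegree_of_totalDegree_lt h

lemma MonicLead.mem {n j : ℕ} {f : MvPolynomial (Fin 2) ℝ} (hf : MonicLead n j f)
    (hj : j ≤ n) : f ∈ lowDegree (n + 1) := by
  rw [← sub_add_cancel f (X 0 ^ (n - j) * X 1 ^ j)]
  exact add_mem (lowDegree_mono n.le_succ hf.sub_mem)
    (X_pow_mul_X_pow_mem_lowDegree (by omega))

lemma X_mul_mem_lowDegree (e : Fin 2) {n : ℕ} {f : MvPolynomial (Fin 2) ℝ}
    (hf : f ∈ lowDegree n) : X e * f ∈ lowDegree (n + 1) := by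
  induction hf using Submodule.span_induction with
  | mem f hf =>
    obtain ⟨a, b, hab, rfl⟩ := hf
    fin_cases e
    · have := X_pow_mul_X_pow_mem_lowDegree (a := a + 1) (b := b) (n := n + 1) (by omega)
      convert this using 1
      simp only [Fin.zero_eta]; ring
    · have := X_pow_mul_X_pow_mem_lowDegree (a := a) (b := b + 1) (n := n + 1) (by omega)
      convert this using 1
      simp only [Fin.mk_one]; ring
  | zero => simp
  | add f g _ _ hf hg => rw [mul_add]; exact add_mem hf hg
  | smul c f _ hf => rw [mul_smul_comm]; exact Submodule.smul_mem _ _ hf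

/-- The substitution `(x, y) ↦ (a x, b y)`. -/
def scaleVars (a b : ℝ) : MvPolynomial (Fin 2) ℝ →ₐ[ℝ] MvPolynomial (Fin 2) ℝ :=
  aeval ![C a * X 0, C b * X 1]

lemma ev_scaleVars (a b : ℝ) (q : ℝ × ℝ) (f : MvPolynomial (Fin 2) ℝ) :
    ev q (scaleVars a b f) = ev (a * q.1, b * q.2) f := by
  induction f using MvPolynomial.induction_on with
  | C c => simp [ev, scaleVars]
  | add f g hf hg => simp only [ev, map_add] at *; rw [hf, hg]
  | mul_X f i hf =>
    simp only [ev, map_mul] at *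
    rw [hf]
    fin_cases i <;> simp [scaleVars]

lemma scaleVars_X_pow_mul_X_pow (a b : ℝ) (s t : ℕ) :
    scaleVars a b (X 0 ^ s * X 1 ^ t) = (a ^ s * b ^ t) • (X 0 ^ s * X 1 ^ t) := by
  simp only [scaleVars, map_mul, map_pow, aeval_X, Matrix.cons_val_zero, Matrix.cons_val_one,
    smul_eq_C_mul]
  ring

lemma scaleVars_mem_lowDegree (a b : ℝ) {n : ℕ} {f : MvPolynomial (Fin 2) ℝ}
    (hf : f ∈ lowDegree n) : scaleVars a b f ∈ lowDegree n := by
  induction hf using Submodule.span_induction with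
  | mem f hf =>
    obtain ⟨s, t, hst, rfl⟩ := hf
    rw [scaleVars_X_pow_mul_X_pow]
    exact Submodule.smul_mem _ _ (X_pow_mul_X_pow_mem_lowDegree hst)
  | zero => simp
  | add f g _ _ hf hg => rw [map_add]; exact add_mem hf hg
  | smul c f _ hf => rw [map_smul]; exact Submodule.smul_mem _ _ hf

section Functional

variable {I : MvPolynomial (Fin 2) ℝ →ₗ[ℝ] ℝ}
  {S : (n : ℕ) → Fin (n + 1) → MvPolynomial (Fin 2) ℝ}

lemma functional_mul_eq_zero_of_mem_lowDegree
    (hlead : ∀ (n : ℕ) (j : Fin (n + 1)), MonicLead n j (S n j))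
    {T : MvPolynomial (Fin 2) ℝ} {n : ℕ}
    (hT : ∀ m < n, ∀ j : Fin (m + 1), I (S m j * T) = 0) :
    ∀ f ∈ lowDegree n, I (f * T) = 0 := by
  induction n with
  | zero =>
    intro f hf
    have : f = 0 := by simpa [lowDegree] using hf
    simp [this]
  | succ n ih =>
    have ih' := ih fun m hm => hT m (hm.trans n.lt_succ_self)
    intro f hf
    induction hf using Submodule.span_induction with
    | mem f hf =>
      obtain ⟨a, b, hab, rfl⟩ := hf
      rcases Nat.lt_succ_iff_lt_or_eq.mp hab with h | h
      · exact ih' _ (X_pow_mul_X_pow_mem_lowDegree h)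
      · have h1 := ih' _ (hlead n ⟨b, by omega⟩).sub_mem
        have h2 := hT n n.lt_succ_self ⟨b, by omega⟩
        rw [sub_mul, map_sub, h2, show n - b = a by omega] at h1
        linarith
    | zero => simp
    | add f g _ _ hf hg => rw [add_mul, map_add, hf, hg, add_zero]
    | smul c f _ hf => rw [smul_mul_assoc, map_smul, hf, smul_zero]

lemma functional_mul_eq_zero_of_sq (hpos : ∀ f, 0 ≤ I (f * f)) {T : MvPolynomial (Fin 2) ℝ}
    (hT : I (T * T) = 0) (q : MvPolynomial (Fin 2) ℝ) : I (q * T) = 0 := by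
  by_contra hne
  have key : ∀ t : ℝ, 0 ≤ I (q * q) + t * (2 * I (q * T)) := fun t => by
    have h := hpos (q + t • T)
    have e : (q + t • T) * (q + t • T) = q * q + (2 * t) • (q * T) + (t * t) • (T * T) := by
      simp only [smul_eq_C_mul, map_mul, map_ofNat]; ring
    rw [e] at h
    simp only [map_add, map_smul, smul_eq_mul, hT] at h
    linarith
  have h := key (-(I (q * q) + 1) / (2 * I (q * T)))
  rw [div_mul_cancel₀ _ (by simpa using hne)] at h
  linarith

lemma functional_mul_eq_zero_of_orthogonal (hpos : ∀ f, 0 ≤ I (f * f))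
    (hlead : ∀ (n : ℕ) (j : Fin (n + 1)), MonicLead n j (S n j))
    {T : MvPolynomial (Fin 2) ℝ} {n : ℕ} (hTn : T ∈ lowDegree n)
    (hT : ∀ m < n, ∀ j : Fin (m + 1), I (S m j * T) = 0) (q : MvPolynomial (Fin 2) ℝ) :
    I (q * T) = 0 :=
  functional_mul_eq_zero_of_sq hpos (functional_mul_eq_zero_of_mem_lowDegree hlead hT T hTn) q

lemma functional_lowDegree_mul_eq_zero
    (hlead : ∀ (n : ℕ) (j : Fin (n + 1)), MonicLead n j (S n j))
    (horth : ∀ m n : ℕ, m ≠ n → ∀ (i : Fin (m + 1)) (j : Fin (n + 1)), I (S m i * S n j) = 0)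
    {n : ℕ} {f : MvPolynomial (Fin 2) ℝ}
    (hf : f ∈ lowDegree n) (j : Fin (n + 1)) : I (f * S n j) = 0 :=
  functional_mul_eq_zero_of_mem_lowDegree hlead
    (fun m hm i => horth m n hm.ne i j) f hf

/-- Monic orthogonal polynomials of a centrally symmetric functional have the parity of their
degree, up to a polynomial annihilated by the functional. -/
lemma functional_mul_scaleVars_neg
    (hlead : ∀ (n : ℕ) (j : Fin (n + 1)), MonicLead n j (S n j))
    (horth : ∀ m n : ℕ, m ≠ n → ∀ (i : Fin (m + 1)) (j : Fin (n + 1)), I (S m i * S n j) = 0)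
    (hpos : ∀ f, 0 ≤ I (f * f))
    (hneg : ∀ f, I (scaleVars (-1) (-1) f) = I f)
    (n : ℕ) (j : Fin (n + 1)) (q : MvPolynomial (Fin 2) ℝ) :
    I (q * scaleVars (-1) (-1) (S n j)) = (-1) ^ n * I (q * S n j) := by
  have hjn : n - (j : ℕ) + j = n := Nat.sub_add_cancel (Nat.lt_succ_iff.mp j.isLt)
  have hinv : ∀ f, scaleVars (-1) (-1) (scaleVars (-1) (-1) f) = f := fun f => by
    refine MvPolynomial.funext fun x => ?_
    have h := (ev_scaleVars (-1) (-1) (x 0, x 1) (scaleVars (-1) (-1) f)).trans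
      (ev_scaleVars (-1) (-1) _ f)
    have hx : ![x 0, x 1] = x := by ext i; fin_cases i <;> rfl
    simp only [ev, neg_one_mul, neg_neg, hx] at h
    exact h
  have hmem : scaleVars (-1) (-1) (S n j) - ((-1 : ℝ) ^ n) • S n j ∈ lowDegree n := by
    have h1 := (hlead n j).sub_mem
    have h2 := scaleVars_mem_lowDegree (-1) (-1) h1
    rw [map_sub, scaleVars_X_pow_mul_X_pow, ← pow_add, hjn] at h2
    convert sub_mem h2 (Submodule.smul_mem _ ((-1 : ℝ) ^ n) h1) using 1
    rw [smul_sub]; abel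
  have hzero := functional_mul_eq_zero_of_orthogonal (I := I) hpos hlead hmem
    (fun m hm i => by
      rw [mul_sub, map_sub, mul_smul_comm, map_smul, horth m n hm.ne, smul_zero, sub_zero,
        ← hneg, map_mul, hinv]
      exact functional_lowDegree_mul_eq_zero hlead horth
        (lowDegree_mono hm (scaleVars_mem_lowDegree _ _ ((hlead m i).mem (by omega)))) j) q
  rwa [mul_sub, map_sub, mul_smul_comm, map_smul, smul_eq_mul, sub_eq_zero] at hzero

lemma functional_X_mul_mul_same_degree
    (hlead : ∀ (n : ℕ) (j : Fin (n + 1)), MonicLead n j (S n j))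
    (horth : ∀ m n : ℕ, m ≠ n → ∀ (i : Fin (m + 1)) (j : Fin (n + 1)), I (S m i * S n j) = 0)
    (hpos : ∀ f, 0 ≤ I (f * f))
    (hneg : ∀ f, I (scaleVars (-1) (-1) f) = I f) (e : Fin 2)
    (n : ℕ) (a b : Fin (n + 1)) : I (X e * S n a * S n b) = 0 := by
  have hX : scaleVars (-1) (-1) (X e) = -X e := by fin_cases e <;> simp [scaleVars]
  have hsq : ((-1 : ℝ) ^ n) * (-1) ^ n = 1 := by rw [← mul_pow]; simp
  have h := hneg (X e * S n a * S n b)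
  rw [map_mul, functional_mul_scaleVars_neg hlead horth hpos hneg, map_mul (scaleVars _ _), hX,
    mul_right_comm, functional_mul_scaleVars_neg hlead horth hpos hneg, ← mul_assoc, hsq,
    neg_mul, neg_mul, map_neg, mul_right_comm (X e)] at h
  linarith

/-- The leading part of multiplication by a variable. -/
lemma functional_X_mul_sub_mem
    (hlead : ∀ (n : ℕ) (j : Fin (n + 1)), MonicLead n j (S n j))
    (e : Fin 2) (n : ℕ) (a : Fin (n + 1)) :
    X e * S n a - S (n + 1) ⟨a + e, by omega⟩ ∈ lowDegree (n + 1) := by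
  have h1 := X_mul_mem_lowDegree e (hlead n a).sub_mem
  have h2 := (hlead (n + 1) ⟨a + e, by omega⟩).sub_mem
  convert sub_mem h1 h2 using 1
  have : X e * (X 0 ^ (n - (a : ℕ)) * X 1 ^ (a : ℕ) : MvPolynomial (Fin 2) ℝ) =
      X 0 ^ (n + 1 - ((a : ℕ) + e)) * X 1 ^ ((a : ℕ) + e) := by
    fin_cases e
    · have : n + 1 - ((a : ℕ) + 0) = n - a + 1 := by omega
      simp only [Fin.zero_eta, this]; ring_nf
    · have : n + 1 - ((a : ℕ) + 1) = n - a := by omega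
      simp only [Fin.mk_one, this]; ring
  rw [mul_sub, this]; abel

lemma functional_mul_X_mul
    (hlead : ∀ (n : ℕ) (j : Fin (n + 1)), MonicLead n j (S n j))
    (horth : ∀ m n : ℕ, m ≠ n → ∀ (i : Fin (m + 1)) (j : Fin (n + 1)), I (S m i * S n j) = 0)
    (e : Fin 2) (n : ℕ) (a : Fin (n + 2)) (b : Fin (n + 1)) :
    I (X e * S n b * S (n + 1) a) = I (S (n + 1) ⟨b + e, by omega⟩ * S (n + 1) a) := by
  have h := functional_lowDegree_mul_eq_zero (I := I) hlead horth
    (functional_X_mul_sub_mem hlead e n b) a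
  rwa [sub_mul, map_sub, sub_eq_zero] at h

lemma functional_X_sq_zero
    (hlead : ∀ (n : ℕ) (j : Fin (n + 1)), MonicLead n j (S n j))
    (horth : ∀ m n : ℕ, m ≠ n → ∀ (i : Fin (m + 1)) (j : Fin (n + 1)), I (S m i * S n j) = 0)
    (hpos : ∀ f, 0 ≤ I (f * f))
    (hneg : ∀ f, I (scaleVars (-1) (-1) f) = I f) (e : Fin 2) (a b : Fin 1) :
    I ((X e * S 0 a) * (X e * S 0 b)) =
      I (S 1 ⟨a + e, by omega⟩ * S 1 ⟨b + e, by omega⟩) := by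
  set T : Fin 1 → MvPolynomial (Fin 2) ℝ := fun a => X e * S 0 a - S 1 ⟨a + e, by omega⟩ with hT
  have null : ∀ a q, I (q * T a) = 0 := fun a q =>
    functional_mul_eq_zero_of_orthogonal hpos hlead
      (functional_X_mul_sub_mem hlead e 0 a) (fun m hm j => by
        obtain rfl : m = 0 := by omega
        rw [mul_comm, sub_mul, map_sub, functional_X_mul_mul_same_degree hlead horth hpos hneg,
          horth _ _ (by omega), sub_zero]) q
  have e1 : ∀ a, X e * S 0 a = S 1 ⟨a + e, by omega⟩ + T a := fun a => by simp [hT]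
  rw [e1 b, mul_add, map_add, null, add_zero, e1 a, mul_comm, mul_add, map_add, null, add_zero,
    mul_comm]

lemma functional_X_sq_succ
    (hlead : ∀ (n : ℕ) (j : Fin (n + 1)), MonicLead n j (S n j))
    (horth : ∀ m n : ℕ, m ≠ n → ∀ (i : Fin (m + 1)) (j : Fin (n + 1)), I (S m i * S n j) = 0)
    (hpos : ∀ f, 0 ≤ I (f * f))
    (hneg : ∀ f, I (scaleVars (-1) (-1) f) = I f) (e : Fin 2) (n : ℕ)
    (G : Fin (n + 2) → Fin (n + 1) → ℝ)
    (hG : ∀ a d, ∑ c, G a c * I (S n c * S n d) = I (S (n + 1) ⟨d + e, by omega⟩ * S (n + 1) a))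
    (a b : Fin (n + 2)) :
    I ((X e * S (n + 1) a) * (X e * S (n + 1) b)) =
      I (S (n + 2) ⟨a + e, by omega⟩ * S (n + 2) ⟨b + e, by omega⟩) +
        ∑ d : Fin (n + 1), I (S (n + 1) ⟨d + e, by omega⟩ * S (n + 1) a) * G b d := by
  set H : Fin (n + 2) → MvPolynomial (Fin 2) ℝ := fun a => ∑ c, G a c • S n c with hH
  have hHS : ∀ a q, I (H a * q) = ∑ c, G a c * I (S n c * q) := fun a q => by
    simp [hH, Finset.sum_mul]
  have hHS' : ∀ a m, m ≠ n → ∀ j : Fin (m + 1), I (H a * S m j) = 0 := fun a m hm j => by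
    rw [hHS]
    exact Finset.sum_eq_zero fun c _ => by rw [horth n m hm.symm, mul_zero]
  set T : Fin (n + 2) → MvPolynomial (Fin 2) ℝ :=
    fun a => X e * S (n + 1) a - S (n + 2) ⟨a + e, by omega⟩ - H a with hT
  have null : ∀ a q, I (q * T a) = 0 := fun a q => by
    refine functional_mul_eq_zero_of_orthogonal (n := n + 2) hpos hlead
      (sub_mem (functional_X_mul_sub_mem hlead e (n + 1) a)
        (Submodule.sum_mem _ fun c _ => Submodule.smul_mem _ _
          (lowDegree_mono (by omega) ((hlead n c).mem (by omega))))) (fun m hm j => ?_) q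
    rw [mul_comm, sub_mul, sub_mul, map_sub, map_sub, horth (n + 2) m (by omega), sub_zero]
    rcases Nat.lt_succ_iff_lt_or_eq.mp hm with hm | rfl
    · rcases Nat.lt_succ_iff_lt_or_eq.mp hm with hm | rfl
      · rw [hHS' a m hm.ne, sub_zero, mul_right_comm]
        exact functional_lowDegree_mul_eq_zero hlead horth (lowDegree_mono (by omega)
          (X_mul_mem_lowDegree e ((hlead m j).mem (by omega)))) a
      · rw [hHS, hG, mul_right_comm, functional_mul_X_mul hlead horth, sub_self]
    · rw [functional_X_mul_mul_same_degree hlead horth hpos hneg, hHS' a _ (by omega), sub_zero]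
  have e1 : ∀ a, X e * S (n + 1) a = S (n + 2) ⟨a + e, by omega⟩ + H a + T a :=
    fun a => by simp [hT]
  have e2 : ∀ a b, I (H a * H b) =
      ∑ d : Fin (n + 1), I (S (n + 1) ⟨d + e, by omega⟩ * S (n + 1) a) * G b d :=
    fun a b => by
      rw [mul_comm, hHS]
      refine Finset.sum_congr rfl fun d _ => ?_
      rw [mul_comm (S n d), hHS, hG, mul_comm]
  rw [e1 b, mul_add, map_add, null, add_zero, e1 a, mul_comm, mul_add, map_add, null, add_zero,
    add_mul, mul_add, mul_add, map_add, map_add, map_add, hHS' b _ (by omega),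
    mul_comm _ (H a), hHS' a _ (by omega), mul_comm (H b), e2, mul_comm (S (n + 2) _)]
  simp only [add_zero, zero_add]

/-- Orthogonal polynomials of the same even degree with different parities are orthogonal. -/
lemma functional_mul_eq_zero_of_parity
    (hlead : ∀ (n : ℕ) (j : Fin (n + 1)), MonicLead n j (S n j))
    (horth : ∀ m n : ℕ, m ≠ n → ∀ (i : Fin (m + 1)) (j : Fin (n + 1)), I (S m i * S n j) = 0)
    (hrefl : ∀ f, I (scaleVars 1 (-1) f) = I f) {n : ℕ} (a b : Fin (n + 1)) (ha : Odd (a : ℕ))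
    (hb : scaleVars 1 (-1) (S n b) = S n b) : I (S n a * S n b) = 0 := by
  have h1 := functional_lowDegree_mul_eq_zero (I := I) hlead horth (hlead n a).sub_mem b
  have h2 := hrefl (X 0 ^ (n - (a : ℕ)) * X 1 ^ (a : ℕ) * S n b)
  rw [map_mul, scaleVars_X_pow_mul_X_pow, hb, one_pow, ha.neg_one_pow, smul_mul_assoc,
    map_smul, smul_eq_mul] at h2
  rw [sub_mul, map_sub] at h1
  linarith

end Functional

lemma ev_mul (q : ℝ × ℝ) (f g : MvPolynomial (Fin 2) ℝ) : ev q (f * g) = ev q f * ev q g :=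
  map_mul _ f g

lemma IsWeight.integrableOn_ev {Ω : Set (ℝ × ℝ)} {W : ℝ × ℝ → ℝ} (hW : IsWeight Ω W)
    (f : MvPolynomial (Fin 2) ℝ) : IntegrableOn (fun q => ev q f * W q) Ω := by
  have h : (fun q => ev q f * W q) =
      fun q => ∑ d ∈ f.support, coeff d f * (q.1 ^ d 0 * q.2 ^ d 1 * W q) := by
    funext q
    simp [ev, eval_eq', Fin.prod_univ_two, Finset.sum_mul, mul_assoc]
  rw [h]
  exact integrable_finsetSum _ fun d _ => (hW.2.2.2.2 (d 0) (d 1)).const_mul _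

/-- The linear functional `f ↦ ∫_Ω f W` on bivariate polynomials. -/
def IsWeight.functional {Ω : Set (ℝ × ℝ)} {W : ℝ × ℝ → ℝ} (hW : IsWeight Ω W) :
    MvPolynomial (Fin 2) ℝ →ₗ[ℝ] ℝ where
  toFun f := ∫ q in Ω, ev q f * W q
  map_add' f g := by
    rw [← integral_add (hW.integrableOn_ev f) (hW.integrableOn_ev g)]
    simp [ev, add_mul]
  map_smul' c f := by
    rw [RingHom.id_apply, smul_eq_mul, ← integral_const_mul]
    simp [ev, mul_assoc]

lemma IsWeight.functional_apply {Ω : Set (ℝ × ℝ)} {W : ℝ × ℝ → ℝ} (hW : IsWeight Ω W)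
    (f : MvPolynomial (Fin 2) ℝ) : hW.functional f = ∫ q in Ω, ev q f * W q := rfl

lemma IsWeight.functional_mul_apply {Ω : Set (ℝ × ℝ)} {W : ℝ × ℝ → ℝ} (hW : IsWeight Ω W)
    (f g : MvPolynomial (Fin 2) ℝ) :
    hW.functional (f * g) = ∫ q in Ω, ev q f * ev q g * W q := by
  simp only [hW.functional_apply, ev_mul]

lemma IsWeight.functional_mul_self_nonneg {Ω : Set (ℝ × ℝ)} {W : ℝ × ℝ → ℝ}
    (hW : IsWeight Ω W) (f : MvPolynomial (Fin 2) ℝ) : 0 ≤ hW.functional (f * f) := by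
  rw [hW.functional_mul_apply]
  exact setIntegral_nonneg hW.1 fun q hq => mul_nonneg (mul_self_nonneg _) (hW.2.2.1 q hq)

lemma XYSymmetric.scale {Ω : Set (ℝ × ℝ)} {W : ℝ × ℝ → ℝ} (h : XYSymmetric Ω W) {a b : ℝ}
    (ha : a * a = 1) (hb : b * b = 1) {q : ℝ × ℝ} (hq : q ∈ Ω) :
    (a * q.1, b * q.2) ∈ Ω ∧ W (a * q.1, b * q.2) = W q := by
  obtain ⟨h1, h2⟩ := h
  rcases mul_self_eq_one_iff.mp ha with rfl | rfl <;>
    rcases mul_self_eq_one_iff.mp hb with rfl | rfl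
  · simpa using hq
  · simpa using And.intro (h1 q hq).2 (h2 q hq).2
  · simpa using And.intro (h1 q hq).1 (h2 q hq).1
  · have h3 := (h1 q hq).1
    simpa using And.intro (h1 _ h3).2 ((h2 _ h3).2.trans (h2 q hq).1)

lemma measurePreserving_scale {a b : ℝ} (ha : a * a = 1) (hb : b * b = 1) :
    MeasurePreserving (fun q : ℝ × ℝ => (a * q.1, b * q.2)) := by
  have key : ∀ c : ℝ, c * c = 1 → MeasurePreserving (fun x : ℝ => c * x) := fun c hc => by
    rcases mul_self_eq_one_iff.mp hc with rfl | rfl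
    · simp only [one_mul]; exact MeasurePreserving.id (volume : Measure ℝ)
    · simpa using Measure.measurePreserving_neg (volume : Measure ℝ)
  exact (key a ha).prod (key b hb)

lemma involutive_scale {a b : ℝ} (ha : a * a = 1) (hb : b * b = 1) :
    Function.Involutive (fun q : ℝ × ℝ => (a * q.1, b * q.2)) := fun q => by
  simp [← mul_assoc, ha, hb]

lemma setIntegral_preimage_involutive {σ : ℝ × ℝ → ℝ × ℝ} (hσ : MeasurePreserving σ)
    (hinv : Function.Involutive σ) (A : Set (ℝ × ℝ)) (h : ℝ × ℝ → ℝ) :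
    ∫ q in σ ⁻¹' A, h (σ q) = ∫ q in A, h q :=
  hσ.setIntegral_preimage_emb (MeasurableEquiv.ofInvolutive σ hinv hσ.measurable).measurableEmbedding
    h A

lemma preimage_eq_self_of_involutive {α : Type*} {σ : α → α} (hinv : Function.Involutive σ)
    {A : Set α} (hA : ∀ q ∈ A, σ q ∈ A) : σ ⁻¹' A = A :=
  Set.Subset.antisymm (fun q hq => by simpa [hinv q] using hA _ hq) hA

lemma IsWeight.functional_scaleVars {Ω : Set (ℝ × ℝ)} {W : ℝ × ℝ → ℝ} (hW : IsWeight Ω W)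
    (hsym : XYSymmetric Ω W) {a b : ℝ} (ha : a * a = 1) (hb : b * b = 1)
    (f : MvPolynomial (Fin 2) ℝ) : hW.functional (scaleVars a b f) = hW.functional f := by
  have h := setIntegral_preimage_involutive (measurePreserving_scale ha hb)
    (involutive_scale ha hb) Ω (fun q => ev q f * W q)
  rw [preimage_eq_self_of_involutive (involutive_scale ha hb)
    fun q hq => (hsym.scale ha hb hq).1] at h
  rw [hW.functional_apply, hW.functional_apply, ← h]
  refine setIntegral_congr_fun hW.1 fun q hq => ?_
  simp only [ev_scaleVars, (hsym.scale ha hb hq).2]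

/-- The integral of a function which is even under a measure-preserving involution is twice its
integral over a half of the domain. -/
lemma setIntegral_eq_two_mul_setIntegral_pos {σ : ℝ × ℝ → ℝ × ℝ} (hσ : MeasurePreserving σ)
    (hinv : Function.Involutive σ) {A : Set (ℝ × ℝ)} (hA : MeasurableSet A)
    (hAσ : ∀ q ∈ A, σ q ∈ A) {φ : ℝ × ℝ → ℝ} (hφ : Measurable φ) (hφσ : ∀ q, φ (σ q) = -φ q)
    (hnull : volume {q | φ q = 0} = 0) {h : ℝ × ℝ → ℝ} (hh : IntegrableOn h A)
    (hhσ : ∀ q ∈ A, h (σ q) = h q) :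
    ∫ q in A, h q = 2 * ∫ q in A ∩ {q | 0 < φ q}, h q := by
  have hpos : MeasurableSet {q | 0 < φ q} := measurableSet_lt measurable_const hφ
  rw [← integral_inter_add_sdiff hpos hh, two_mul]
  congr 1
  have hpre : σ ⁻¹' (A ∩ {q | 0 < φ q}) = A ∩ {q | φ q < 0} := by
    rw [Set.preimage_inter, preimage_eq_self_of_involutive hinv hAσ]
    ext q; simp [hφσ]
  rw [← setIntegral_preimage_involutive hσ hinv (A ∩ _), hpre,
    ← setIntegral_congr_fun (hA.inter (measurableSet_lt hφ measurable_const))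
      (fun q hq => (hhσ q hq.1).symm)]
  refine setIntegral_congr_set ?_
  have hne : ∀ᵐ q : ℝ × ℝ, φ q ≠ 0 := by rw [ae_iff]; simpa using hnull
  filter_upwards [hne] with q hq
  refine propext (and_congr_right fun _ => ?_)
  exact ⟨fun h => lt_of_le_of_ne (not_lt.mp h) hq,
    fun (h : φ q < 0) (h' : 0 < φ q) => lt_asymm h h'⟩

lemma volume_fst_eq_zero : volume {q : ℝ × ℝ | q.1 = 0} = 0 := by
  have : {q : ℝ × ℝ | q.1 = 0} = {0} ×ˢ Set.univ := by ext q; simp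
  rw [this, Measure.volume_eq_prod, Measure.prod_prod, Real.volume_singleton, zero_mul]

lemma volume_snd_eq_zero : volume {q : ℝ × ℝ | q.2 = 0} = 0 := by
  have : {q : ℝ × ℝ | q.2 = 0} = Set.univ ×ˢ {0} := by ext q; simp
  rw [this, Measure.volume_eq_prod, Measure.prod_prod, Real.volume_singleton, mul_zero]

/-- The substitution `u = x²`, `v = y²`. -/
lemma setIntegral_Ωstar {Ω : Set (ℝ × ℝ)} (hΩ : MeasurableSet Ω) (W F : ℝ × ℝ → ℝ) :
    ∫ q in Ωstar Ω, F q * W00 W q =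
      ∫ q in Ω ∩ {q | 0 < q.1} ∩ {q | 0 < q.2}, F (q.1 ^ 2, q.2 ^ 2) * W q := by
  set s : Set (ℝ × ℝ) := Ω ∩ {q | 0 < q.1} ∩ {q | 0 < q.2} with hs
  have hsm : MeasurableSet s := (hΩ.inter (measurableSet_lt measurable_const measurable_fst)).inter
    (measurableSet_lt measurable_const measurable_snd)
  set f : ℝ × ℝ → ℝ × ℝ := fun q => (q.1 ^ 2, q.2 ^ 2) with hf
  have himage : f '' s = Ωstar Ω ∩ {q | q.1 ≠ 0 ∧ q.2 ≠ 0} := by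
    ext ⟨u, v⟩
    constructor
    · rintro ⟨⟨x, y⟩, ⟨⟨hxy, hx⟩, hy⟩, h⟩
      simp only [Set.mem_ofPred_eq] at hx hy
      obtain ⟨rfl, rfl⟩ : x ^ 2 = u ∧ y ^ 2 = v := by simpa [hf] using h
      refine ⟨⟨sq_nonneg x, sq_nonneg y, ?_⟩, by positivity, by positivity⟩
      simpa only [Real.sqrt_sq hx.le, Real.sqrt_sq hy.le] using hxy
    · rintro ⟨⟨hu, hv, hm⟩, hu0, hv0⟩
      refine ⟨(√u, √v), ⟨⟨hm, ?_⟩, ?_⟩, ?_⟩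
      · exact Real.sqrt_pos.mpr (lt_of_le_of_ne hu (Ne.symm hu0))
      · exact Real.sqrt_pos.mpr (lt_of_le_of_ne hv (Ne.symm hv0))
      · simp only [hf]; rw [Real.sq_sqrt hu, Real.sq_sqrt hv]
  have hae : Ωstar Ω =ᵐ[volume] f '' s := by
    rw [himage]
    have h1 : ∀ᵐ q : ℝ × ℝ, q.1 ≠ 0 := by rw [ae_iff]; simpa using volume_fst_eq_zero
    have h2 : ∀ᵐ q : ℝ × ℝ, q.2 ≠ 0 := by rw [ae_iff]; simpa using volume_snd_eq_zero
    filter_upwards [h1, h2] with q hq1 hq2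
    exact propext ⟨fun h => ⟨h, hq1, hq2⟩, fun h => h.1⟩
  have hinj : Set.InjOn f s := by
    rintro ⟨x, y⟩ ⟨⟨-, hx⟩, hy⟩ ⟨x', y'⟩ ⟨⟨-, hx'⟩, hy'⟩ h
    simp only [Set.mem_ofPred_eq] at hx hy hx' hy'
    simp only [hf, Prod.mk.injEq] at h
    rw [Prod.mk.injEq]
    exact ⟨(pow_left_inj₀ hx.le hx'.le two_ne_zero).mp h.1,
      (pow_left_inj₀ hy.le hy'.le two_ne_zero).mp h.2⟩
  set f' : ℝ × ℝ → (ℝ × ℝ →L[ℝ] ℝ × ℝ) := fun q =>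
    ((2 * q.1) • ContinuousLinearMap.id ℝ ℝ).prodMap ((2 * q.2) • ContinuousLinearMap.id ℝ ℝ)
    with hf'
  have hderiv : ∀ q ∈ s, HasFDerivWithinAt f (f' q) s q := fun q _ => by
    have h : ∀ x : ℝ, HasFDerivAt (fun x : ℝ => x ^ 2)
        ((2 * x) • ContinuousLinearMap.id ℝ ℝ) x := fun x => by
      refine (hasDerivAt_pow 2 x).hasFDerivAt.congr_fderiv ?_
      ext; simp
    exact (HasFDerivAt.prodMap q (h q.1) (h q.2)).hasFDerivWithinAt
  have hdet : ∀ q, (f' q).det = 4 * (q.1 * q.2) := fun q => by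
    have : ((f' q : ℝ × ℝ →L[ℝ] ℝ × ℝ) : ℝ × ℝ →ₗ[ℝ] ℝ × ℝ) =
      ((2 * q.1) • LinearMap.id (R := ℝ) (M := ℝ)).prodMap
        ((2 * q.2) • LinearMap.id (R := ℝ) (M := ℝ)) := rfl
    rw [ContinuousLinearMap.det, this, LinearMap.det_prodMap]
    simp only [LinearMap.det_smul, LinearMap.det_id, Module.finrank_self]
    ring
  rw [setIntegral_congr_set hae, integral_image_eq_integral_abs_det_fderiv_smul _ hsm hderiv hinj]
  refine setIntegral_congr_fun hsm ?_
  rintro ⟨x, y⟩ ⟨⟨-, hx⟩, hy⟩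
  simp only [Set.mem_ofPred_eq] at hx hy
  have hxy := mul_pos hx hy
  simp only [hdet, hf, W00, smul_eq_mul, Real.sqrt_sq hx.le, Real.sqrt_sq hy.le]
  rw [← mul_pow, Real.sqrt_sq hxy.le, abs_of_pos (by positivity)]
  field_simp

lemma IsWeight.setIntegral_Ωstar_eq {Ω : Set (ℝ × ℝ)} {W : ℝ × ℝ → ℝ} (hW : IsWeight Ω W)
    (hsym : XYSymmetric Ω W) (F : ℝ × ℝ → ℝ) (g : MvPolynomial (Fin 2) ℝ)
    (hg : ∀ q, ev q g = F (q.1 ^ 2, q.2 ^ 2)) :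
    ∫ q in Ωstar Ω, F q * W00 W q = (1 / 4) * hW.functional g := by
  have hx : (-1 : ℝ) * -1 = 1 := by norm_num
  have hy : (1 : ℝ) * 1 = 1 := by norm_num
  have hpos : MeasurableSet {q : ℝ × ℝ | 0 < q.1} := measurableSet_lt measurable_const measurable_fst
  rw [setIntegral_Ωstar hW.1, hW.functional_apply,
    setIntegral_eq_two_mul_setIntegral_pos (measurePreserving_scale hx hy) (involutive_scale hx hy)
      hW.1 (fun q hq => (hsym.scale hx hy hq).1) measurable_fst (fun q => by simp)
      volume_fst_eq_zero (hW.integrableOn_ev g)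
      (fun q hq => by rw [(hsym.scale hx hy hq).2]; simp [hg]),
    setIntegral_eq_two_mul_setIntegral_pos (measurePreserving_scale hy hx) (involutive_scale hy hx)
      (hW.1.inter hpos) (fun q hq => ⟨(hsym.scale hy hx hq.1).1, by simpa using hq.2⟩)
      measurable_snd (fun q => by simp) volume_snd_eq_zero
      ((hW.integrableOn_ev g).mono_set Set.inter_subset_left)
      (fun q hq => by rw [(hsym.scale hy hx hq.1).2]; simp [hg])]
  simp only [hg]
  ring

section Selection

open Matrix

lemma Jmat_mul {r c d : ℕ} (h : ∀ i : Fin r, 2 * (i : ℕ) < c) (M : Matrix (Fin c) (Fin d) ℝ)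
    (i : Fin r) (j : Fin d) : (Jmat r c 0 * M) i j = M ⟨2 * i, h i⟩ j := by
  rw [Matrix.mul_apply, Finset.sum_eq_single ⟨2 * (i : ℕ), h i⟩]
  · simp [Jmat]
  · intro b _ hb
    have : (b : ℕ) ≠ 2 * i := fun e => hb (Fin.ext e)
    simp [Jmat, this]
  · simp

lemma mul_Jmat_transpose {r c d : ℕ} (h : ∀ i : Fin r, 2 * (i : ℕ) < c)
    (M : Matrix (Fin d) (Fin c) ℝ) (i : Fin d) (j : Fin r) :
    (M * (Jmat r c 0)ᵀ) i j = M i ⟨2 * j, h j⟩ := by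
  have := Jmat_mul h Mᵀ j i
  rwa [← Matrix.transpose_apply (Jmat r c 0 * Mᵀ), Matrix.transpose_mul,
    Matrix.transpose_transpose, Matrix.transpose_apply] at this

lemma Lmat_mul {n k d : ℕ} {e : Fin 2} (he : (e : ℕ) = k - 1) (M : Matrix (Fin (n + 2)) (Fin d) ℝ)
    (i : Fin (n + 1)) (j : Fin d) : (Lmat n k * M) i j = M ⟨i + e, by omega⟩ j := by
  rw [Matrix.mul_apply, Finset.sum_eq_single ⟨i + e, by omega⟩]
  · simp [Lmat, he]
  · intro b _ hb
    have : (b : ℕ) ≠ i + (k - 1) := fun h => hb (Fin.ext (h.trans (by simp only [he])))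
    simp [Lmat, this]
  · simp

lemma mul_Lmat_transpose {n k d : ℕ} {e : Fin 2} (he : (e : ℕ) = k - 1)
    (M : Matrix (Fin d) (Fin (n + 2)) ℝ) (i : Fin d) (j : Fin (n + 1)) :
    (M * (Lmat n k)ᵀ) i j = M i ⟨j + e, by omega⟩ := by
  have := Lmat_mul he Mᵀ j i
  rwa [← Matrix.transpose_apply (Lmat n k * Mᵀ), Matrix.transpose_mul,
    Matrix.transpose_transpose, Matrix.transpose_apply] at this

lemma Jmat_mul_Lmat_mul_Lmat {k : ℕ} {e : Fin 2} (he : (e : ℕ) = k - 1) (m : ℕ) :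
    Jmat (m + 1) (2 * m + 1) 0 * (Lmat (2 * m) k * Lmat (2 * m + 1) k) =
      Lmat m k * Jmat (m + 2) (2 * m + 3) 0 := by
  ext i j
  rw [Jmat_mul (fun i => by omega), Lmat_mul he, Lmat_mul he]
  simp only [Lmat, Jmat, Matrix.of_apply]
  refine if_congr ?_ rfl rfl
  omega

lemma mul_Jmat_transpose_eq {n : ℕ} {M : Matrix (Fin (2 * n + 1)) (Fin (2 * n + 1)) ℝ}
    (hM : ∀ a : Fin (2 * n + 1), Odd (a : ℕ) → ∀ j : Fin (n + 1), M a ⟨2 * j, by omega⟩ = 0) :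
    (Jmat (n + 1) (2 * n + 1) 0)ᵀ * (Jmat (n + 1) (2 * n + 1) 0 * M *
      (Jmat (n + 1) (2 * n + 1) 0)ᵀ) = M * (Jmat (n + 1) (2 * n + 1) 0)ᵀ := by
  ext a j
  have h : ∀ i : Fin (n + 1), 2 * (i : ℕ) < 2 * n + 1 := fun i => by omega
  rw [mul_Jmat_transpose h, Matrix.mul_apply]
  simp only [mul_Jmat_transpose h, Jmat_mul h]
  rcases Nat.even_or_odd' (a : ℕ) with ⟨b, hb | hb⟩
  · have hab : a = ⟨2 * b, by omega⟩ := Fin.ext hb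
    rw [Finset.sum_eq_single ⟨b, by omega⟩]
    · simp [Jmat, hab]
    · intro c _ hc
      have : (a : ℕ) ≠ 2 * c := fun h => hc (Fin.ext (by simp only; omega))
      simp [Jmat, this]
    · simp
  · rw [hM a ⟨b, hb⟩]
    refine Finset.sum_eq_zero fun c _ => ?_
    have : (a : ℕ) ≠ 2 * c := by omega
    simp [Jmat, this]

lemma mul_inv_eq_Jmat_mul_mul {n : ℕ} {M A : Matrix (Fin (2 * n + 1)) (Fin (2 * n + 1)) ℝ}
    (hM : ∀ a : Fin (2 * n + 1), Odd (a : ℕ) → ∀ j : Fin (n + 1), M a ⟨2 * j, by omega⟩ = 0)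
    {P U : Matrix (Fin (n + 1)) (Fin (n + 1)) ℝ} (hP : IsUnit P.det)
    (hPM : ∀ i j, P i j = 1 / 4 * M ⟨2 * i, by omega⟩ ⟨2 * j, by omega⟩)
    (hU : ∀ i j, U i j = 1 / 4 * (A * M) ⟨2 * i, by omega⟩ ⟨2 * j, by omega⟩) :
    U * P⁻¹ = Jmat (n + 1) (2 * n + 1) 0 * A * (Jmat (n + 1) (2 * n + 1) 0)ᵀ := by
  have h : ∀ i : Fin (n + 1), 2 * (i : ℕ) < 2 * n + 1 := fun i => by omega
  have hJM := mul_Jmat_transpose_eq hM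
  set J := Jmat (n + 1) (2 * n + 1) 0
  have eP : P = (1 / 4 : ℝ) • (J * M * Jᵀ) := by
    ext i j
    rw [hPM, Matrix.smul_apply, mul_Jmat_transpose h, Jmat_mul h, smul_eq_mul]
  have eU : U = (1 / 4 : ℝ) • (J * (A * M) * Jᵀ) := by
    ext i j
    rw [hU, Matrix.smul_apply, mul_Jmat_transpose h, Jmat_mul h, smul_eq_mul]
  have key : U = J * A * Jᵀ * P := by
    rw [eP, eU, Matrix.mul_smul, Matrix.mul_assoc (J * A), hJM]
    simp only [Matrix.mul_assoc]
  rw [key, Matrix.mul_nonsing_inv_cancel_right _ _ hP]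

lemma mul_Lmat_transpose_mul_inv {k : ℕ} {e : Fin 2} (he : (e : ℕ) = k - 1) {m : ℕ}
    {M : Matrix (Fin (2 * m + 1)) (Fin (2 * m + 1)) ℝ}
    {M₁ : Matrix (Fin (2 * m + 2)) (Fin (2 * m + 2)) ℝ}
    {M₂ : Matrix (Fin (2 * m + 3)) (Fin (2 * m + 3)) ℝ}
    (hM : ∀ a : Fin (2 * m + 1), Odd (a : ℕ) → ∀ j : Fin (m + 1), M a ⟨2 * j, by omega⟩ = 0)
    {Γ₁ : Matrix (Fin (2 * m + 2)) (Fin (2 * m + 1)) ℝ}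
    {Γ₂ : Matrix (Fin (2 * m + 3)) (Fin (2 * m + 2)) ℝ}
    (hΓ₁ : Γ₁ * M = M₁ * (Lmat (2 * m) k)ᵀ) (hΓ₂ : Γ₂ * M₁ = M₂ * (Lmat (2 * m + 1) k)ᵀ)
    {P : Matrix (Fin (m + 1)) (Fin (m + 1)) ℝ} {P' : Matrix (Fin (m + 2)) (Fin (m + 2)) ℝ}
    (hP : IsUnit P.det)
    (hPM : ∀ i j, P i j = 1 / 4 * M ⟨2 * i, by omega⟩ ⟨2 * j, by omega⟩)
    (hPM' : ∀ i j, P' i j = 1 / 4 * M₂ ⟨2 * i, by omega⟩ ⟨2 * j, by omega⟩) :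
    P' * (Lmat m k)ᵀ * P⁻¹ = Jmat (m + 2) (2 * m + 3) 0 * (Γ₂ * Γ₁) *
      (Jmat (m + 1) (2 * m + 1) 0)ᵀ := by
  have h : ∀ i : Fin (m + 1), 2 * (i : ℕ) < 2 * m + 1 := fun i => by omega
  have h' : ∀ i : Fin (m + 2), 2 * (i : ℕ) < 2 * m + 3 := fun i => by omega
  have hJL := Jmat_mul_Lmat_mul_Lmat he m
  have hJM := mul_Jmat_transpose_eq hM
  set J := Jmat (m + 1) (2 * m + 1) 0
  set J' := Jmat (m + 2) (2 * m + 3) 0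
  have eP : P = (1 / 4 : ℝ) • (J * M * Jᵀ) := by
    ext i j
    rw [hPM, Matrix.smul_apply, mul_Jmat_transpose h, Jmat_mul h, smul_eq_mul]
  have eP' : P' = (1 / 4 : ℝ) • (J' * M₂ * J'ᵀ) := by
    ext i j
    rw [hPM', Matrix.smul_apply, mul_Jmat_transpose h', Jmat_mul h', smul_eq_mul]
  have key : P' * (Lmat m k)ᵀ = J' * (Γ₂ * Γ₁) * Jᵀ * P := by
    rw [eP, eP', Matrix.mul_smul, Matrix.mul_assoc (J' * _), hJM,
      Matrix.smul_mul, Matrix.mul_assoc (J' * M₂), ← Matrix.transpose_mul, ← hJL]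
    congr 1
    calc _ = J' * (M₂ * (Lmat (2 * m + 1) k)ᵀ) * (Lmat (2 * m) k)ᵀ * Jᵀ := by
          simp only [Matrix.transpose_mul, Matrix.mul_assoc]
      _ = J' * (Γ₂ * (M₁ * (Lmat (2 * m) k)ᵀ)) * Jᵀ := by
          rw [← hΓ₂]; simp only [Matrix.mul_assoc]
      _ = _ := by rw [← hΓ₁]; simp only [Matrix.mul_assoc]
  rw [key, Matrix.mul_nonsing_inv_cancel_right _ _ hP]

end Selection

open Matrix in
/-- Bäcklund-type relations for the family `{P̂ₙ^(0,0)}` (case `(i,j) = (0,0)` of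
Theorem `Backlund`): with `Γ_{n,k} = 𝐒ₙ L_{n-1,k}ᵀ 𝐒_{n-1}⁻¹` (here `Γp m k = Γ_{m+1,k}`),
`D̂_{n,k}^(0,0) = J_n⁽⁰'⁰⁾ [L_{2n,k} Γ_{2n+1,k} + Γ_{2n,k} L_{2n-1,k}] (J_n⁽⁰'⁰⁾)ᵀ` and
`Ĉ_{n,k}^(0,0) = J_n⁽⁰'⁰⁾ Γ_{2n,k} Γ_{2n-1,k} (J_{n-1}⁽⁰'⁰⁾)ᵀ`, where
`D̂_{n,k}^(0,0) = (∫ u_k P̂ₙ P̂ₙᵀ W⁽⁰'⁰⁾) 𝐏̂ₙ⁻¹` and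
`Ĉ_{n,k}^(0,0) = 𝐏̂ₙ L_{n-1,k}ᵀ 𝐏̂_{n-1}⁻¹`; the first identity is stated for `n = 0`
(where `Γ_{2n,k} L_{2n-1,k}` is empty, hence `0`) and for `n = m + 1 ≥ 1`, the second
for `n = m + 1 ≥ 1`, matrices with negative indices being zero. -/
theorem stmt15 (Ω : Set (ℝ × ℝ)) (W : ℝ × ℝ → ℝ) (hW : IsWeight Ω W)
    (hsym : XYSymmetric Ω W)
    (S : (n : ℕ) → Fin (n + 1) → MvPolynomial (Fin 2) ℝ) (hS : IsMOPS Ω W S)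
    (Smat : (n : ℕ) → Matrix (Fin (n + 1)) (Fin (n + 1)) ℝ)
    (hSmat : ∀ (n : ℕ) (i j : Fin (n + 1)),
      Smat n i j = ∫ q in Ω, ev q (S n i) * ev q (S n j) * W q)
    (hSdet : ∀ n : ℕ, IsUnit (Smat n).det)
    (Γp : (m : ℕ) → ℕ → Matrix (Fin (m + 2)) (Fin (m + 1)) ℝ)
    (hΓ : ∀ (m kk : ℕ), Γp m kk = Smat (m + 1) * (Lmat m kk)ᵀ * (Smat m)⁻¹)
    (p : (n : ℕ) → Fin (n + 1) → MvPolynomial (Fin 2) ℝ)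
    (hrel : ∀ (n : ℕ) (j : Fin (n + 1)) (x y : ℝ),
      eval ![x, y] (S (2 * n) ⟨2 * (j : ℕ), by have := j.isLt; omega⟩) =
        eval ![x ^ 2, y ^ 2] (p n j))
    (Pmat : (n : ℕ) → Matrix (Fin (n + 1)) (Fin (n + 1)) ℝ)
    (hPmat : ∀ (n : ℕ) (i j : Fin (n + 1)),
      Pmat n i j = ∫ q in Ωstar Ω, ev q (p n i) * ev q (p n j) * W00 W q)
    (hPdet : ∀ n : ℕ, IsUnit (Pmat n).det)
    (k : ℕ) (hk : k = 1 ∨ k = 2) :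
    ((Matrix.of fun i j : Fin 1 =>
        ∫ q in Ωstar Ω, (if k = 1 then q.1 else q.2) *
          (ev q (p 0 i) * ev q (p 0 j) * W00 W q)) * (Pmat 0)⁻¹ =
      Jmat 1 1 0 * (Lmat 0 k * Γp 0 k) * (Jmat 1 1 0)ᵀ) ∧
    (∀ m : ℕ,
      (Matrix.of fun i j : Fin (m + 2) =>
        ∫ q in Ωstar Ω, (if k = 1 then q.1 else q.2) *
          (ev q (p (m + 1) i) * ev q (p (m + 1) j) * W00 W q)) * (Pmat (m + 1))⁻¹ =
      Jmat (m + 2) (2 * m + 3) 0 *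
        (Lmat (2 * m + 2) k * Γp (2 * m + 2) k + Γp (2 * m + 1) k * Lmat (2 * m + 1) k) *
        (Jmat (m + 2) (2 * m + 3) 0)ᵀ) ∧
    (∀ m : ℕ,
      Pmat (m + 1) * (Lmat m k)ᵀ * (Pmat m)⁻¹ =
      Jmat (m + 2) (2 * m + 3) 0 * (Γp (2 * m + 1) k * Γp (2 * m) k) *
        (Jmat (m + 1) (2 * m + 1) 0)ᵀ) := by
  have hpos := hW.functional_mul_self_nonneg
  have hrefl := hW.functional_scaleVars hsym (a := 1) (b := -1) (by norm_num) (by norm_num)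
  have hneg := hW.functional_scaleVars hsym (a := -1) (b := -1) (by norm_num) (by norm_num)
  set I := hW.functional
  obtain ⟨hlead, horth⟩ := hS
  replace horth : ∀ m n : ℕ, m ≠ n → ∀ (i : Fin (m + 1)) (j : Fin (n + 1)),
      I (S m i * S n j) = 0 := fun m n hmn i j => by
    rw [hW.functional_mul_apply]; exact horth m n hmn i j
  have hSI : ∀ n i j, Smat n i j = I (S n i * S n j) := fun n i j => by
    rw [hSmat, hW.functional_mul_apply]
  have hsymm : ∀ n, (Smat n)ᵀ = Smat n := fun n => by
    ext i j; rw [Matrix.transpose_apply, hSI, hSI, mul_comm]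
  have hΓS : ∀ m, Γp m k * Smat m = Smat (m + 1) * (Lmat m k)ᵀ := fun m => by
    rw [hΓ, Matrix.nonsing_inv_mul_cancel_right _ _ (hSdet m)]
  obtain ⟨e, he, heX⟩ : ∃ e : Fin 2, (e : ℕ) = k - 1 ∧
      ∀ q : ℝ × ℝ, ev q (X e * X e) = if k = 1 then q.1 ^ 2 else q.2 ^ 2 := by
    rcases hk with rfl | rfl
    · exact ⟨0, rfl, fun q => by simp [ev, sq]⟩
    · exact ⟨1, rfl, fun q => by simp [ev, sq]⟩
  have hev : ∀ (n : ℕ) (i : Fin (n + 1)) (q : ℝ × ℝ),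
      ev q (S (2 * n) ⟨2 * i, by omega⟩) = ev (q.1 ^ 2, q.2 ^ 2) (p n i) :=
    fun n i q => hrel n i q.1 q.2
  have heven : ∀ (n : ℕ) (j : Fin (n + 1)),
      scaleVars 1 (-1) (S (2 * n) ⟨2 * j, by omega⟩) = S (2 * n) ⟨2 * j, by omega⟩ :=
    fun n j => by
      refine MvPolynomial.funext fun x => ?_
      have hx : ![x 0, x 1] = x := by ext i; fin_cases i <;> rfl
      have h := ev_scaleVars 1 (-1) (x 0, x 1) (S (2 * n) ⟨2 * j, by omega⟩)
      rw [hev, show ((1 * x 0) ^ 2, (-1 * x 1) ^ 2) = (x 0 ^ 2, x 1 ^ 2) by simp,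
        ← hev n j (x 0, x 1)] at h
      rw [← hx]
      exact h
  have hodd : ∀ (n : ℕ) (a : Fin (2 * n + 1)), Odd (a : ℕ) → ∀ j : Fin (n + 1),
      Smat (2 * n) a ⟨2 * j, by omega⟩ = 0 := fun n a ha j => by
    rw [hSI]
    exact functional_mul_eq_zero_of_parity hlead horth hrefl _ _ ha (heven n j)
  have hP : ∀ (n : ℕ) (i j : Fin (n + 1)),
      Pmat n i j = 1 / 4 * Smat (2 * n) ⟨2 * i, by omega⟩ ⟨2 * j, by omega⟩ := fun n i j => by
    rw [hPmat, hSI]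
    exact hW.setIntegral_Ωstar_eq hsym (fun q => ev q (p n i) * ev q (p n j)) _
      fun q => by rw [ev_mul, hev, hev]
  have hU : ∀ (n : ℕ) (i j : Fin (n + 1)),
      ∫ q in Ωstar Ω, (if k = 1 then q.1 else q.2) * (ev q (p n i) * ev q (p n j) * W00 W q) =
        1 / 4 * I ((X e * S (2 * n) ⟨2 * i, by omega⟩) * (X e * S (2 * n) ⟨2 * j, by omega⟩)) :=
    fun n i j => by
      rw [← hW.setIntegral_Ωstar_eq hsym
        (fun q => (if k = 1 then q.1 else q.2) * (ev q (p n i) * ev q (p n j)))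
        _ fun q => by rw [mul_mul_mul_comm, ev_mul q (X e * X e), heX, ev_mul, hev, hev]]
      simp only [mul_assoc]
  refine ⟨?_, fun m => ?_, fun m => ?_⟩
  · refine mul_inv_eq_Jmat_mul_mul (n := 0) (hodd 0) (hPdet 0) (hP 0) fun i j => ?_
    rw [Matrix.of_apply, hU 0, Matrix.mul_assoc, hΓS, Lmat_mul he, mul_Lmat_transpose he, hSI]
    exact congrArg _ (functional_X_sq_zero hlead horth hpos hneg e _ _)
  · refine mul_inv_eq_Jmat_mul_mul (n := m + 1) (hodd (m + 1)) (hPdet (m + 1)) (hP (m + 1))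
      fun i j => ?_
    have hΓt : Γp (2 * m + 1) k * Lmat (2 * m + 1) k * Smat (2 * m + 2) =
        Smat (2 * m + 2) * (Lmat (2 * m + 1) k)ᵀ * (Γp (2 * m + 1) k)ᵀ := by
      rw [hΓ, Matrix.transpose_mul, Matrix.transpose_mul, Matrix.transpose_transpose,
        Matrix.transpose_nonsing_inv, hsymm, hsymm]
      simp only [Matrix.mul_assoc]
    have hquad := functional_X_sq_succ hlead horth hpos hneg e (2 * m + 1) (Γp (2 * m + 1) k)
      (fun a d => by
        have := congrFun (congrFun (hΓS (2 * m + 1)) a) d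
        rw [mul_Lmat_transpose he, Matrix.mul_apply, hSI, mul_comm (S _ _)] at this
        simpa only [hSI] using this)
      ⟨2 * i, by omega⟩ ⟨2 * j, by omega⟩
    rw [Matrix.of_apply, hU (m + 1)]
    refine congrArg _ (hquad.trans ?_)
    change _ = ((Lmat (2 * m + 2) k * Γp (2 * m + 2) k +
      Γp (2 * m + 1) k * Lmat (2 * m + 1) k) * Smat (2 * m + 2)) _ _
    rw [Matrix.add_mul, Matrix.add_apply, Matrix.mul_assoc, hΓS, Lmat_mul he,
      mul_Lmat_transpose he, hSI, hΓt, Matrix.mul_apply]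
    congr 1
    refine Finset.sum_congr rfl fun d _ => ?_
    rw [mul_Lmat_transpose he, hSI, Matrix.transpose_apply, mul_comm (S _ _)]
  · exact mul_Lmat_transpose_mul_inv he (hodd m) (hΓS (2 * m)) (hΓS (2 * m + 1)) (hPdet m) (hP m)
      (hP (m + 1))
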